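/- There is no function h from the set of binary strings of length at most 2 to ^{<ω}2 such that: (1) for all binary strings η ◁ ν of length at most 2, h(η) ⊥ h(ν); and (2) for all binary strings η, ν of length at most 2 with η ⊥ ν, h(η) and h(ν) are comparable (h(η) ⊴ h(ν) or h(ν) ⊴ h(η), equality allowed). (Combinatorial content of Remark 4.10(ii): the parameters of a witness of SOP₂ cannot be rearranged into an antichain tree of height 2.) -/

import Mathlib

/-- The meet `η ∧ ν` of two finite binary strings: their longest common prefix. -/
def lcp : List Bool → List Bool → List Bool
  | a :: as, b :: bs => if a = b then a :: lcp as bs else []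
  | _, _ => []

/-- `η ⊥ ν`: the strings are incomparable (neither is a prefix of the other). -/
def Incomp (a b : List Bool) : Prop := ¬ a <+: b ∧ ¬ b <+: a

/-- A tuple of strings is ∧-closed if the meet of any two entries is again an entry. -/
def MeetClosed {ι : Type*} (t : ι → List Bool) : Prop :=
  ∀ i j : ι, ∃ k : ι, lcp (t i) (t j) = t k

/-- `s ≈_α t`: both tuples are ∧-closed, and they satisfy the same
`⊴`-relations and the same `⌢⟨d⟩⊴`-relations between entries. -/
def EqvA {ι : Type*} (s t : ι → List Bool) : Prop :=
  MeetClosed s ∧ MeetClosed t ∧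
  (∀ i j : ι, s i <+: s j ↔ t i <+: t j) ∧
  (∀ (i j : ι) (d : Bool), s i ++ [d] <+: s j ↔ t i ++ [d] <+: t j)

/-- `s ≈_β t`: `≈_α` together with preservation of the relation `ηᵢ⌢⟨1⟩ = ηⱼ`. -/
def EqvB {ι : Type*} (s t : ι → List Bool) : Prop :=
  EqvA s t ∧ ∀ i j : ι, s i ++ [true] = s j ↔ t i ++ [true] = t j

/-- `s ≈_γ t`: `≈_β` together with preservation of `ηᵢ⌢⟨0⟩ = ηⱼ` and of
ending with `0` resp. with `1`. -/
def EqvG {ι : Type*} (s t : ι → List Bool) : Prop :=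
  EqvB s t ∧
  (∀ i j : ι, s i ++ [false] = s j ↔ t i ++ [false] = t j) ∧
  (∀ i : ι, (s i).getLast? = some false ↔ (t i).getLast? = some false) ∧
  (∀ i : ι, (s i).getLast? = some true ↔ (t i).getLast? = some true)

/-- The meet-closure tuple of a tuple of strings: all pairwise meets. -/
def cl {ι : Type*} (t : ι → List Bool) : ι × ι → List Bool :=
  fun p => lcp (t p.1) (t p.2)

/-- The comparability graph of the prefix order has no induced 4-cycle: if `a ⊥ c` and `b ⊥ d`, then
`a`, `c` cannot both be comparable to each of `b`, `d`. -/
theorem not_comparable_square {a b c d : List Bool} (hac : Incomp a c) (hbd : Incomp b d)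
    (hab : a <+: b ∨ b <+: a) (hbc : b <+: c ∨ c <+: b)
    (hcd : c <+: d ∨ d <+: c) (hda : d <+: a ∨ a <+: d) : False := by
  have hb : ¬ (a <+: b ∧ c <+: b) := fun h =>
    (List.prefix_or_prefix_of_prefix h.1 h.2).elim hac.1 hac.2
  have hd : ¬ (a <+: d ∧ c <+: d) := fun h =>
    (List.prefix_or_prefix_of_prefix h.1 h.2).elim hac.1 hac.2
  have ha : ¬ (b <+: a ∧ d <+: a) := fun h =>
    (List.prefix_or_prefix_of_prefix h.1 h.2).elim hbd.1 hbd.2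
  have hc : ¬ (b <+: c ∧ d <+: c) := fun h =>
    (List.prefix_or_prefix_of_prefix h.1 h.2).elim hbd.1 hbd.2
  have hadc : ¬ (a <+: d ∧ d <+: c) := fun h => hac.1 (h.1.trans h.2)
  have hcda : ¬ (c <+: d ∧ d <+: a) := fun h => hac.2 (h.1.trans h.2)
  tauto

/-- Remark 4.10(ii), combinatorial content: there is no map `h` on binary
strings of length at most 2 sending strict chains to incomparable pairs while
sending incomparable pairs to comparable strings. -/
theorem stmt16 :
    ¬ ∃ h : List Bool → List Bool,
      (∀ η ν : List Bool, η.length ≤ 2 → ν.length ≤ 2 → η <+: ν → η ≠ ν →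
        Incomp (h η) (h ν)) ∧
      (∀ η ν : List Bool, η.length ≤ 2 → ν.length ≤ 2 → Incomp η ν →
        (h η <+: h ν ∨ h ν <+: h η)) := by
  rintro ⟨h, hchain, hanti⟩
  exact not_comparable_square
    (hchain [false] [false, false] (by decide) (by decide) (by decide) (by decide))
    (hchain [true] [true, false] (by decide) (by decide) (by decide) (by decide))
    (hanti [false] [true] (by decide) (by decide) (by unfold Incomp; decide))
    (hanti [true] [false, false] (by decide) (by decide) (by unfold Incomp; decide))
    (hanti [false, false] [true, false] (by decide) (by decide) (by unfold Incomp; decide))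
    (hanti [true, false] [false] (by decide) (by decide) (by unfold Incomp; decide))
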